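/- Let r ∈ (0, π/2) and define f(y) = y² + (arccos(cos r·cosh y))² for y ∈ [−arcosh(1/cos r), arcosh(1/cos r)]. Then f attains its minimum on this interval only at y = 0, where f(0) = r², and f is twice differentiable at 0 with f''(0) = 2·(1 − r·cot r), which is strictly positive. -/

import Mathlib

open Real MeasureTheory Filter Topology Set

noncomputable section

/-- The inverse hyperbolic cosine, `arcosh x = log (x + √(x² - 1))` for `x ≥ 1`. -/
def arcosh (x : ℝ) : ℝ := Real.log (x + Real.sqrt (x ^ 2 - 1))

theorem sinh_lt_self_mul_cosh {y : ℝ} (hy : 0 < y) : Real.sinh y < y * Real.cosh y := by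
  have hd (x : ℝ) : HasDerivAt (fun t => t * Real.cosh t - Real.sinh t) (x * Real.sinh x) x := by
    refine (((hasDerivAt_id x).mul (Real.hasDerivAt_cosh x)).sub
      (Real.hasDerivAt_sinh x)).congr_deriv ?_
    simp
  have hmono : StrictMonoOn (fun t => t * Real.cosh t - Real.sinh t) (Set.Ici 0) := by
    refine strictMonoOn_of_deriv_pos (convex_Ici 0) (by fun_prop) fun x hx => ?_
    rw [interior_Ici, Set.mem_Ioi] at hx
    rw [(hd x).deriv]
    exact mul_pos hx (Real.sinh_pos_iff.2 hx)
  have h := hmono Set.self_mem_Ici hy.le hy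
  simp only [Real.sinh_zero, zero_mul, sub_zero] at h
  linarith

theorem self_mul_cos_lt_sin {t : ℝ} (h₀ : 0 < t) (h₁ : t < π / 2) :
    t * Real.cos t < Real.sin t := by
  have hc : 0 < Real.cos t := Real.cos_pos_of_mem_Ioo ⟨by linarith, h₁⟩
  have h := Real.lt_tan h₀ h₁
  rwa [Real.tan_eq_sin_div_cos, lt_div_iff₀ hc] at h

/-- The ratio `c θ / sin θ`, where `θ = arccos (c cosh y)`. -/
def phaseRatio (c y : ℝ) : ℝ :=
  c * Real.arccos (c * Real.cosh y) / √(1 - (c * Real.cosh y) ^ 2)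

theorem hasDerivAt_phase {c y : ℝ} (h₀ : 0 < c * Real.cosh y) (h₁ : c * Real.cosh y < 1) :
    HasDerivAt (fun y => y ^ 2 + Real.arccos (c * Real.cosh y) ^ 2)
      (2 * (y - phaseRatio c y * Real.sinh y)) y := by
  have hθ := (Real.hasDerivAt_arccos (by linarith) h₁.ne).comp y
    ((Real.hasDerivAt_cosh y).const_mul c)
  refine ((hasDerivAt_pow 2 y).add (hθ.pow 2)).congr_deriv ?_
  simp only [phaseRatio, Function.comp_apply]
  push_cast
  ring

theorem phaseRatio_mul_sinh_lt {c y : ℝ} (hc : 0 < c) (hy : 0 < y)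
    (h₁ : c * Real.cosh y < 1) : phaseRatio c y * Real.sinh y < y := by
  have hx : 0 < c * Real.cosh y := mul_pos hc (Real.cosh_pos y)
  have hθ₀ : 0 < Real.arccos (c * Real.cosh y) := Real.arccos_pos.2 h₁
  have h := self_mul_cos_lt_sin hθ₀ (Real.arccos_lt_pi_div_two.2 hx)
  rw [Real.cos_arccos (by linarith) h₁.le, Real.sin_arccos] at h
  have hs : 0 < √(1 - (c * Real.cosh y) ^ 2) := lt_trans (mul_pos hθ₀ hx) h
  rw [phaseRatio, div_mul_eq_mul_div, div_lt_iff₀ hs]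
  calc c * Real.arccos (c * Real.cosh y) * Real.sinh y
      < c * Real.arccos (c * Real.cosh y) * (y * Real.cosh y) :=
        mul_lt_mul_of_pos_left (sinh_lt_self_mul_cosh hy) (mul_pos hc hθ₀)
    _ = y * (Real.arccos (c * Real.cosh y) * (c * Real.cosh y)) := by ring
    _ < y * √(1 - (c * Real.cosh y) ^ 2) := mul_lt_mul_of_pos_left h hy

theorem strictMonoOn_phase {c a : ℝ} (hc : 0 < c) (ha : c * Real.cosh a = 1) :
    StrictMonoOn (fun y => y ^ 2 + Real.arccos (c * Real.cosh y) ^ 2) (Set.Icc 0 a) := by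
  refine strictMonoOn_of_deriv_pos (convex_Icc 0 a)
    (by have := Real.continuous_arccos; fun_prop) fun y hy => ?_
  rw [interior_Icc] at hy
  have h₁ : c * Real.cosh y < 1 := ha ▸ mul_lt_mul_of_pos_left
    (Real.cosh_strictMonoOn hy.1.le (hy.1.trans hy.2).le hy.2) hc
  rw [(hasDerivAt_phase (mul_pos hc (Real.cosh_pos y)) h₁).deriv]
  linarith [phaseRatio_mul_sinh_lt hc hy.1 h₁]

theorem hasDerivAt_deriv_phase {c : ℝ} (h₀ : 0 < c) (h₁ : c < 1) :
    HasDerivAt (deriv fun y => y ^ 2 + Real.arccos (c * Real.cosh y) ^ 2)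
      (2 * (1 - phaseRatio c 0)) 0 := by
  have hsq : 0 < 1 - (c * Real.cosh 0) ^ 2 := by
    rw [Real.cosh_zero, mul_one]
    nlinarith
  have hlin : DifferentiableAt ℝ (fun y => c * Real.cosh y) 0 := by fun_prop
  have harccos : DifferentiableAt ℝ (fun y => Real.arccos (c * Real.cosh y)) 0 := by
    refine DifferentiableAt.comp (g := Real.arccos) (0 : ℝ)
      (Real.differentiableAt_arccos.2 ?_) hlin
    rw [Real.cosh_zero, mul_one]
    exact ⟨by linarith, h₁.ne⟩
  have hratio : DifferentiableAt ℝ (phaseRatio c) 0 :=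
    (harccos.const_mul c).div (((hlin.pow 2).const_sub 1).sqrt hsq.ne') (Real.sqrt_pos.2 hsq).ne'
  have hd : HasDerivAt (fun y => 2 * (y - phaseRatio c y * Real.sinh y))
      (2 * (1 - phaseRatio c 0)) 0 := by
    refine (((hasDerivAt_id (0 : ℝ)).sub
      (hratio.hasDerivAt.mul (Real.hasDerivAt_sinh 0))).const_mul 2).congr_deriv ?_
    simp
  refine hd.congr_of_eventuallyEq ?_
  have hev : ∀ᶠ y in 𝓝 (0 : ℝ), c * Real.cosh y < 1 :=
    hlin.continuousAt.eventually_lt continuousAt_const (by simpa using h₁)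
  filter_upwards [hev] with y hy
  exact (hasDerivAt_phase (mul_pos h₀ (Real.cosh_pos y)) hy).deriv

/-- the Laplace phase `f(y) = y² + arccos(cos r · cosh y)²` attains its minimum
on `[-arcosh(1/cos r), arcosh(1/cos r)]` only at `y = 0`, with `f(0) = r²`, and `f` is twice
differentiable at `0` with `f''(0) = 2(1 - r cot r) > 0`. -/
theorem stmt_13 (r : ℝ) (hr : r ∈ Set.Ioo 0 (π / 2)) (f : ℝ → ℝ)
    (hf : ∀ y : ℝ, f y = y ^ 2 + Real.arccos (Real.cos r * Real.cosh y) ^ 2)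
    (a : ℝ) (ha : a = _root_.arcosh (1 / Real.cos r)) :
    (∀ y ∈ Set.Icc (-a) a, f 0 ≤ f y) ∧
    (∀ y ∈ Set.Icc (-a) a, f y = f 0 → y = 0) ∧
    f 0 = r ^ 2 ∧
    DifferentiableAt ℝ f 0 ∧ DifferentiableAt ℝ (deriv f) 0 ∧
    deriv (deriv f) 0 = 2 * (1 - r * Real.cot r) ∧
    0 < 2 * (1 - r * Real.cot r) := by
  obtain ⟨hr₀, hr₁⟩ := hr
  have hc₀ : 0 < Real.cos r := Real.cos_pos_of_mem_Ioo ⟨by linarith, hr₁⟩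
  have hs₀ : 0 < Real.sin r := Real.sin_pos_of_pos_of_lt_pi hr₀ (by linarith [Real.pi_pos])
  have hc₁ : Real.cos r < 1 := by nlinarith [Real.sin_sq_add_cos_sq r]
  have hcosh : Real.cos r * Real.cosh a = 1 := by
    have h : Real.cosh a = 1 / Real.cos r :=
      ha ▸ Real.cosh_arcosh ((one_le_div hc₀).2 hc₁.le)
    rw [h, mul_one_div_cancel hc₀.ne']
  have harccos : Real.arccos (Real.cos r) = r := Real.arccos_cos hr₀.le (by linarith)
  have hratio : phaseRatio (Real.cos r) 0 = r * Real.cot r := by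
    rw [phaseRatio, Real.cosh_zero, mul_one, harccos, ← Real.sin_sq, Real.sqrt_sq hs₀.le,
      Real.cot_eq_cos_div_sin]
    ring
  obtain rfl : f = fun y => y ^ 2 + Real.arccos (Real.cos r * Real.cosh y) ^ 2 := funext hf
  have hlt : ∀ y ∈ Set.Icc (-a) a, y ≠ 0 →
      (0 : ℝ) ^ 2 + Real.arccos (Real.cos r * Real.cosh 0) ^ 2 <
        y ^ 2 + Real.arccos (Real.cos r * Real.cosh y) ^ 2 := by
    intro y hy hy₀
    have hya : |y| ≤ a := abs_le.2 hy
    have h := strictMonoOn_phase hc₀ hcosh ⟨le_rfl, (abs_nonneg y).trans hya⟩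
      ⟨abs_nonneg y, hya⟩ (abs_pos.2 hy₀)
    simpa only [sq_abs, Real.cosh_abs] using h
  have hd := hasDerivAt_deriv_phase hc₀ hc₁
  rw [hratio] at hd
  refine ⟨fun y hy => ?_, fun y hy h => ?_, ?_, ?_, hd.differentiableAt, hd.deriv, ?_⟩
  · rcases eq_or_ne y 0 with rfl | hy₀
    · exact le_rfl
    · exact (hlt y hy hy₀).le
  · by_contra hy₀
    exact (hlt y hy hy₀).ne' h
  · simp [harccos]
  · exact (hasDerivAt_phase (by simpa using hc₀) (by simpa using hc₁)).differentiableAt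
  · have h : r * Real.cot r < 1 := by
      rw [Real.cot_eq_cos_div_sin, ← mul_div_assoc, div_lt_one hs₀]
      exact self_mul_cos_lt_sin hr₀ hr₁
    linarith

end
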